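/- Let p be an odd prime, R = F_p + vF_p with v^2 = v, and ϑ = 1 − 2v or ϑ = −1 + 2v, written ϑ = λ + vμ. Let C be a ϑ-constacyclic code of length n over R with generating set in standard form {v·g_{1−v}(x), (1−v)·g_v(x)}; write x^n − (λ+μ) = g_{1−v}(x)h_{1−v}(x) and x^n − λ = g_v(x)h_v(x), with monic reciprocals h*_{1−v}(x), h*_v(x). Let φ_ϑ be the Gray map from R^n to F_p^{2n} determined by ϑ. Then φ_ϑ(C^⊥) = [h*_{1−v}(x)h*_v(x)], the cyclic code of length 2n over F_p with generator polynomial h*_{1−v}(x)h*_v(x), and moreover φ_ϑ(C^⊥) = (φ_ϑ(C))^⊥. -/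

import Mathlib

open Polynomial

def vR (p : ℕ) : ZMod p × ZMod p := (0, 1)

def ofFHom (p : ℕ) : ZMod p →+* ZMod p × ZMod p :=
  RingHom.prod (RingHom.id _) (RingHom.id _)

def shift {m : ℕ} {S : Type*} [Mul S] (θ : S) (c : Fin m → S) : Fin m → S :=
  fun i =>
    if h : (i : ℕ) = 0 then θ * c ⟨m - 1, by have := i.isLt; omega⟩
    else c ⟨(i : ℕ) - 1, by have := i.isLt; omega⟩

def IsConstacyclic {m : ℕ} {S : Type*} [Mul S] (θ : S) (C : Set (Fin m → S)) : Prop :=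
  ∀ c ∈ C, shift θ c ∈ C

def dualCode {m : ℕ} {S : Type*} [CommRing S] (C : Set (Fin m → S)) : Set (Fin m → S) :=
  {u | ∀ w ∈ C, ∑ i, u i * w i = 0}

/-- identification of a word `(c_0, …, c_{m-1}) ∈ S^m` with the polynomial
`c_0 + c_1 x + ⋯ + c_{m-1} x^{m-1}`. -/
noncomputable def toPoly {m : ℕ} {S : Type*} [Semiring S] (c : Fin m → S) : S[X] :=
  ∑ i : Fin m, Polynomial.C (c i) * X ^ (i : ℕ)

/-- The monic reciprocal polynomial `h*(x) = h(0)⁻¹ · x^{deg h} · h(1/x)`. -/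
noncomputable def recip {p : ℕ} (h : (ZMod p)[X]) : (ZMod p)[X] :=
  Polynomial.C (h.coeff 0)⁻¹ * h.reverse

/-- The Gray map `φ_ϑ : R^n → F_p^{2n}` attached to `ϑ = λ + vμ`: writing
`c_i = r_i + v·q_i` (so `r_i = τ(c_i)` and `q_i = σ(c_i) - τ(c_i)`), it sends
`(c_0, …, c_{n-1})` to
`(λ(λ+μ)q_0, …, λ(λ+μ)q_{n-1}, -μr_0 - (λ+μ)q_0, …, -μr_{n-1} - (λ+μ)q_{n-1})`. -/
def grayVec (p n : ℕ) (lam mu : ZMod p) (c : Fin n → ZMod p × ZMod p) :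
    Fin (2 * n) → ZMod p :=
  fun j =>
    if h : (j : ℕ) < n then
      lam * (lam + mu) * ((c ⟨j, h⟩).2 - (c ⟨j, h⟩).1)
    else
      -mu * (c ⟨(j : ℕ) - n, by have := j.isLt; omega⟩).1 -
        (lam + mu) * ((c ⟨(j : ℕ) - n, by have := j.isLt; omega⟩).2 -
          (c ⟨(j : ℕ) - n, by have := j.isLt; omega⟩).1)

section ToPoly

variable {S : Type*} [Semiring S] {m : ℕ}

theorem coeff_toPoly (c : Fin m → S) (k : ℕ) :
    (toPoly c).coeff k = if h : k < m then c ⟨k, h⟩ else 0 := by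
  simp only [toPoly, finsetSum_coeff, coeff_C_mul_X_pow]
  split_ifs with h
  · rw [Finset.sum_eq_single ⟨k, h⟩]
    · simp
    · intro b _ hb
      rw [if_neg]
      rintro rfl
      exact hb rfl
    · simp
  · refine Finset.sum_eq_zero fun i _ => if_neg ?_
    rintro rfl
    exact h i.isLt

theorem degree_toPoly_lt (c : Fin m → S) : (toPoly c).degree < m := by
  rw [degree_lt_iff_coeff_zero]
  intro k hk
  rw [coeff_toPoly, dif_neg (by omega)]

theorem toPoly_coeff {P : S[X]} (hP : P.degree < m) :
    toPoly (fun i : Fin m => P.coeff i) = P := by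
  ext k
  rw [coeff_toPoly]
  split_ifs with h
  · rfl
  · exact (degree_lt_iff_coeff_zero _ _ |>.1 hP k (by omega)).symm

theorem map_toPoly {T : Type*} [Semiring T] (f : S →+* T) (c : Fin m → S) :
    (toPoly c).map f = toPoly (fun i => f (c i)) := by
  simp [toPoly, Polynomial.map_sum]

end ToPoly

section Reciprocal

variable {K : Type*} [Field K]

theorem reverse_dvd_iff {n : ℕ} {h U : K[X]} (h0 : h.coeff 0 ≠ 0) (hU : U.degree < n) :
    h.reverse ∣ U ↔ h ∣ reflect (n - 1) U := by
  rcases eq_or_ne U 0 with rfl | hU0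
  · simp
  have hUn : U.natDegree ≤ n - 1 := by
    have := (natDegree_lt_iff_degree_lt hU0).2 hU
    omega
  have hrev : h.reverse.natDegree = h.natDegree := by
    rw [reverse_natDegree, natTrailingDegree_eq_zero_of_constantCoeff_ne_zero h0, Nat.sub_zero]
  have key : ∀ a q : K[X], a ≠ 0 → q ≠ 0 → (a * q).natDegree ≤ n - 1 →
      reflect (n - 1) (a * q) =
        reflect a.natDegree a * reflect (n - 1 - a.natDegree) q := by
    intro a q ha hq hd
    rw [natDegree_mul ha hq] at hd
    rw [← reflect_mul a q le_rfl (by omega : q.natDegree ≤ n - 1 - a.natDegree)]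
    congr 1
    omega
  constructor
  · rintro ⟨q, rfl⟩
    rw [key _ _ (left_ne_zero_of_mul hU0) (right_ne_zero_of_mul hU0) hUn, hrev, reverse,
      reflect_reflect]
    exact dvd_mul_right _ _
  · rintro ⟨q, hq⟩
    have hUq : U = reflect (n - 1) (h * q) := by rw [← hq, reflect_reflect]
    have hhq : h * q ≠ 0 := by
      intro hz
      rw [hz, reflect_zero] at hUq
      exact hU0 hUq
    have hd : (h * q).natDegree ≤ n - 1 := by
      rw [← hq, natDegree_le_iff_coeff_eq_zero]
      intro N hN
      rw [coeff_reflect, revAt_eq_self_of_lt hN]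
      exact coeff_eq_zero_of_natDegree_lt (by omega)
    rw [hUq, key _ _ (left_ne_zero_of_mul hhq) (right_ne_zero_of_mul hhq) hd]
    exact dvd_mul_right _ _

theorem coeff_reflect_mul (U W : K[X]) (N : ℕ) :
    (W * reflect N U).coeff N = ∑ i ∈ Finset.range (N + 1), U.coeff i * W.coeff i := by
  rw [coeff_mul, Finset.Nat.sum_antidiagonal_eq_sum_range_succ_mk]
  refine Finset.sum_congr rfl fun i hi => ?_
  rw [Finset.mem_range] at hi
  rw [coeff_reflect, revAt_le (Nat.sub_le _ _), Nat.sub_sub_self (by omega), mul_comm]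

/-- Multiples `g * f` with `f` of degree less than `n - deg g` are annihilated by the top
coefficient functional of `V` exactly when `V` is a multiple of the cofactor of `g`. -/
theorem dvd_iff_forall_coeff_eq_zero {n : ℕ} (hn : 0 < n) {c : K} {g h V : K[X]}
    (hgh : X ^ n - C c = g * h) (hV : V.degree < n) :
    h ∣ V ↔ ∀ W : K[X], W.degree < n → g ∣ W → (W * V).coeff (n - 1) = 0 := by
  have hne : g * h ≠ 0 := hgh ▸ X_pow_sub_C_ne_zero hn c
  have hg := left_ne_zero_of_mul hne
  have hh := right_ne_zero_of_mul hne
  have hdeg : g.natDegree + h.natDegree = n := by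
    rw [← natDegree_mul hg hh, ← hgh, natDegree_X_pow_sub_C]
  constructor
  · rintro ⟨q, rfl⟩ W hW ⟨f, rfl⟩
    rcases eq_or_ne q 0 with rfl | hq
    · simp
    rcases eq_or_ne f 0 with rfl | hf
    · simp
    rw [← natDegree_lt_iff_degree_lt (mul_ne_zero ‹_› ‹_›), natDegree_mul ‹_› ‹_›] at hV hW
    have : g * f * (h * q) = f * q * X ^ n - C c * (f * q) := by
      linear_combination -(f * q) * hgh
    rw [this, coeff_sub, coeff_mul_X_pow', if_neg (by omega), coeff_C_mul,
      coeff_eq_zero_of_natDegree_lt (p := f * q), mul_zero, sub_zero]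
    rw [natDegree_mul hf hq]
    omega
  · intro H
    have hcoeff : ∀ k, g.natDegree ≤ k → k < n → (g * V).coeff k = 0 := by
      intro k hk hkn
      have := H (g * X ^ (n - 1 - k)) ?_ (dvd_mul_right _ _)
      · rw [show g * X ^ (n - 1 - k) * V = g * V * X ^ (n - 1 - k) by ring, coeff_mul_X_pow',
          if_pos (by omega), show n - 1 - (n - 1 - k) = k by omega] at this
        exact this
      · rw [← natDegree_lt_iff_degree_lt (mul_ne_zero hg (by simp)), natDegree_mul hg (by simp),
          natDegree_X_pow]
        omega
    have hdegV : ∀ k, g.natDegree + n ≤ k → (g * V).coeff k = 0 := by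
      intro k hk
      rcases eq_or_ne V 0 with rfl | hV0
      · simp
      apply coeff_eq_zero_of_natDegree_lt
      rw [natDegree_mul hg hV0]
      have := (natDegree_lt_iff_degree_lt hV0).2 hV
      omega
    set A := divX^[n] (g * V) with hA
    have hAc : ∀ k, A.coeff k = (g * V).coeff (k + n) := by
      intro k
      rw [hA]
      clear_value A
      clear hA hcoeff hdegV H hV hdeg hgh hn
      induction n generalizing k with
      | zero => simp
      | succ n ih => rw [Function.iterate_succ_apply', coeff_divX, ih]; congr 1; omega
    have hrem : g * (V - h * A) = 0 := by
      refine eq_zero_of_dvd_of_degree_lt (dvd_mul_right g _) ?_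
      rw [degree_eq_natDegree hg, degree_lt_iff_coeff_zero]
      intro k hk
      have : g * (V - h * A) = g * V - A * X ^ n + C c * A := by
        linear_combination A * hgh
      rw [this, coeff_add, coeff_sub, coeff_mul_X_pow', coeff_C_mul, hAc k,
        hdegV (k + n) (by omega), mul_zero, add_zero]
      split_ifs with hkn
      · rw [hAc, Nat.sub_add_cancel hkn, sub_self]
      · rw [hcoeff k hk (by omega), sub_zero]
    exact ⟨A, sub_eq_zero.1 ((mul_eq_zero.1 hrem).resolve_left hg)⟩

theorem coeff_zero_ne_zero_of_X_pow_sub_C_eq_mul {n : ℕ} (hn : 0 < n) {c : K} (hc : c ≠ 0)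
    {g h : K[X]} (hgh : X ^ n - C c = g * h) : h.coeff 0 ≠ 0 := by
  intro h0
  have := congrArg (fun P => coeff P 0) hgh
  simp [mul_coeff_zero, h0, hn.ne, coeff_X_pow] at this
  exact hc this

/-- The dual of the constacyclic code generated by `g` is generated by the reciprocal of the
check polynomial `h`. -/
theorem mem_dual_iff_reverse_dvd {n : ℕ} (hn : 0 < n) {c : K} (hc : c ≠ 0) {g h : K[X]}
    (hgh : X ^ n - C c = g * h) (u : Fin n → K) :
    (∀ w : Fin n → K, g ∣ toPoly w → ∑ i, u i * w i = 0) ↔ h.reverse ∣ toPoly u := by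
  have h0 := coeff_zero_ne_zero_of_X_pow_sub_C_eq_mul hn hc hgh
  have hdot : ∀ w : Fin n → K, (toPoly w * reflect (n - 1) (toPoly u)).coeff (n - 1) =
      ∑ i, u i * w i := by
    intro w
    rw [coeff_reflect_mul, Nat.sub_add_cancel hn, Finset.sum_range]
    exact Finset.sum_congr rfl fun i _ => by simp [coeff_toPoly]
  rw [reverse_dvd_iff h0 (degree_toPoly_lt u), dvd_iff_forall_coeff_eq_zero hn hgh]
  · constructor
    · intro H W hW hgW
      rw [← toPoly_coeff hW] at hgW ⊢
      rw [hdot]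
      exact H _ hgW
    · intro H w hw
      rw [← hdot]
      exact H _ (degree_toPoly_lt w) hw
  · rw [degree_lt_iff_coeff_zero]
    intro k hk
    rw [coeff_reflect, revAt_eq_self_of_lt (by omega), coeff_toPoly, dif_neg (by omega)]

theorem reverse_dvd_X_pow_sub_C {n : ℕ} {c : K} (hc : c * c = 1) {g h : K[X]}
    (hgh : X ^ n - C c = g * h) : h.reverse ∣ X ^ n - C c := by
  have hrev : (X ^ n - C c : K[X]).reverse = 1 - C c * X ^ n := by
    rw [reverse, natDegree_X_pow_sub_C, reflect_sub, reflect_C, ← one_mul (X ^ n : K[X]), ← C_1,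
      reflect_C_mul_X_pow, revAt_le le_rfl]
    simp
  have h1 : h.reverse ∣ (X ^ n - C c : K[X]).reverse :=
    ⟨g.reverse, by rw [hgh, reverse_mul_of_domain, mul_comm]⟩
  have h2 : (X ^ n - C c : K[X]) = (X ^ n - C c : K[X]).reverse * (-C c) := by
    have : (C c * C c : K[X]) = 1 := by rw [← C_mul, hc, C_1]
    rw [hrev]
    linear_combination -(X ^ n) * this
  rw [h2]
  exact h1.mul_right _

end Reciprocal

theorem associated_recip {p : ℕ} [Fact p.Prime] {h : (ZMod p)[X]} (h0 : h.coeff 0 ≠ 0) :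
    Associated (recip h) h.reverse :=
  (associated_isUnit_mul_left_iff (isUnit_C.2 (inv_ne_zero h0).isUnit)).2 (Associated.refl _)

theorem polynomial_prod_ext {A B : Type*} [Semiring A] [Semiring B] {P Q : (A × B)[X]}
    (h1 : P.map (RingHom.fst A B) = Q.map (RingHom.fst A B))
    (h2 : P.map (RingHom.snd A B) = Q.map (RingHom.snd A B)) : P = Q := by
  ext k
  · simpa using congrArg (fun T => coeff T k) h1
  · simpa using congrArg (fun T => coeff T k) h2

section Gray

variable {p n : ℕ} {lam mu : ZMod p}

theorem grayVec_lower (hl : lam * lam = 1) (hm : mu = -2 * lam)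
    (c : Fin n → ZMod p × ZMod p) (i : Fin n) (hi : (i : ℕ) < 2 * n) :
    grayVec p n lam mu c ⟨i, hi⟩ = (c i).1 - (c i).2 := by
  simp only [grayVec, Fin.is_lt, dite_true, Fin.eta, hm]
  linear_combination ((c i).1 - (c i).2) * hl

theorem grayVec_upper (hm : mu = -2 * lam)
    (c : Fin n → ZMod p × ZMod p) (i : Fin n) (hi : (i : ℕ) + n < 2 * n) :
    grayVec p n lam mu c ⟨i + n, hi⟩ = lam * ((c i).1 + (c i).2) := by
  have : ¬ (i : ℕ) + n < n := by omega
  simp only [grayVec, this, dite_false, Nat.add_sub_cancel, Fin.eta, hm]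
  ring

theorem toPoly_grayVec (hl : lam * lam = 1) (hm : mu = -2 * lam)
    (c : Fin n → ZMod p × ZMod p) :
    toPoly (grayVec p n lam mu c) =
      C lam * (toPoly (fun i => (c i).1) * (X ^ n + C lam) +
        toPoly (fun i => (c i).2) * (X ^ n - C lam)) := by
  ext k
  simp only [coeff_toPoly, coeff_C_mul, mul_add, mul_sub, coeff_add, coeff_sub, coeff_mul_X_pow',
    coeff_mul_C]
  rcases lt_or_ge k n with hk | hk
  · have := grayVec_lower hl hm c ⟨k, hk⟩ (by simp only; omega)
    simp only at this
    rw [dif_pos (by omega), this, if_neg (by omega), if_neg (by omega), dif_pos hk, dif_pos hk]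
    linear_combination -((c ⟨k, hk⟩).1 - (c ⟨k, hk⟩).2) * hl
  · rw [if_pos hk, if_pos hk, dif_neg (show ¬ k < n by omega), dif_neg (show ¬ k < n by omega)]
    obtain ⟨j, rfl⟩ := Nat.exists_eq_add_of_le' hk
    simp only [Nat.add_sub_cancel]
    by_cases hj : j < n
    · have := grayVec_upper hm c ⟨j, hj⟩ (by simp only; omega)
      simp only at this
      rw [dif_pos (by omega), this, dif_pos hj, dif_pos hj]
      ring
    · rw [dif_neg (by omega), dif_neg hj, dif_neg hj]
      ring

theorem sum_fin_two_mul {M : Type*} [AddCommMonoid M] (F : Fin (2 * n) → M) :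
    ∑ j, F j = ∑ i : Fin n, (F ⟨i, by omega⟩ + F ⟨i + n, by omega⟩) := by
  rw [← (finCongr (two_mul n).symm).sum_comp, Fin.sum_univ_add, Finset.sum_add_distrib]
  congr 1
  refine Finset.sum_congr rfl fun i _ => congrArg F (Fin.ext ?_)
  simp [add_comm]

theorem sum_grayVec_mul (hl : lam * lam = 1) (hm : mu = -2 * lam)
    (u w : Fin n → ZMod p × ZMod p) :
    ∑ j, grayVec p n lam mu u j * grayVec p n lam mu w j =
      2 * ((∑ i, u i * w i).1 + (∑ i, u i * w i).2) := by
  rw [sum_fin_two_mul, Prod.fst_sum, Prod.snd_sum, ← Finset.sum_add_distrib, Finset.mul_sum]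
  refine Finset.sum_congr rfl fun i _ => ?_
  rw [grayVec_lower hl hm, grayVec_lower hl hm, grayVec_upper hm, grayVec_upper hm,
    Prod.fst_mul, Prod.snd_mul]
  linear_combination ((u i).1 + (u i).2) * ((w i).1 + (w i).2) * hl

theorem grayVec_surjective [Fact p.Prime] (h2 : (2 : ZMod p) ≠ 0) (hl : lam * lam = 1)
    (hm : mu = -2 * lam) : Function.Surjective (grayVec p n lam mu) := by
  intro y
  let u : Fin n → ZMod p × ZMod p := fun i =>
    ((y ⟨i, by omega⟩ + lam * y ⟨i + n, by omega⟩) / 2,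
      (lam * y ⟨i + n, by omega⟩ - y ⟨i, by omega⟩) / 2)
  refine ⟨u, funext fun ⟨j, hj⟩ => ?_⟩
  rcases lt_or_ge j n with hjn | hjn
  · have := grayVec_lower hl hm u ⟨j, hjn⟩ hj
    rw [this]
    simp only [u]
    field_simp
    ring
  · obtain ⟨i, rfl⟩ := Nat.exists_eq_add_of_le' hjn
    have := grayVec_upper hm u ⟨i, by omega⟩ hj
    rw [this]
    simp only [u]
    field_simp
    linear_combination 2 * y ⟨i + n, hj⟩ * hl

/-- The Gray map turns duals of `R`-linear codes into duals of codes over `F_p`. -/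
theorem grayVec_image_dualCode [Fact p.Prime] (h2 : (2 : ZMod p) ≠ 0) (hl : lam * lam = 1)
    (hm : mu = -2 * lam) (D : Submodule (ZMod p × ZMod p) (Fin n → ZMod p × ZMod p)) :
    grayVec p n lam mu '' dualCode (D : Set (Fin n → ZMod p × ZMod p)) =
      dualCode (grayVec p n lam mu '' (D : Set (Fin n → ZMod p × ZMod p))) := by
  ext y
  constructor
  · rintro ⟨u, hu, rfl⟩ _ ⟨w, hw, rfl⟩
    rw [sum_grayVec_mul hl hm, hu w hw]
    simp
  · intro hy
    obtain ⟨u, rfl⟩ := grayVec_surjective h2 hl hm y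
    refine ⟨u, fun w hw => ?_, rfl⟩
    have key : ∀ r : ZMod p × ZMod p,
        (r * ∑ i, u i * w i).1 + (r * ∑ i, u i * w i).2 = 0 := by
      intro r
      have h := hy _ ⟨r • w, D.smul_mem r hw, rfl⟩
      rw [sum_grayVec_mul hl hm] at h
      have hr : ∑ i, u i * (r • w) i = r * ∑ i, u i * w i := by
        rw [Finset.mul_sum]
        exact Finset.sum_congr rfl fun i _ => by simp [mul_left_comm]
      rw [← hr]
      exact (mul_eq_zero.1 h).resolve_left h2
    exact Prod.ext (by simpa using key (1, 0)) (by simpa using key (0, 1))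

end Gray

section Components

variable {p n : ℕ} {lam mu : ZMod p} {g1v gv h1v hv : (ZMod p)[X]}

theorem fst_comp_ofFHom (p : ℕ) :
    (RingHom.fst (ZMod p) (ZMod p)).comp (ofFHom p) = RingHom.id _ := rfl

theorem snd_comp_ofFHom (p : ℕ) :
    (RingHom.snd (ZMod p) (ZMod p)).comp (ofFHom p) = RingHom.id _ := rfl

/-- A code with generators `v·g_{1-v}`, `(1-v)·g_v` is the product of its two components. -/
theorem mem_code_iff [Fact p.Prime] (hn : 0 < n)
    {D : Set (Fin n → ZMod p × ZMod p)}
    (hgen : {x : (ZMod p × ZMod p)[X] ⧸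
        Ideal.span {(X : (ZMod p × ZMod p)[X]) ^ n -
          Polynomial.C (ofFHom p lam + vR p * ofFHom p mu)} |
        ∃ c ∈ D, x = Ideal.Quotient.mk _ (toPoly c)} =
      ↑(Ideal.span
        {Ideal.Quotient.mk (Ideal.span {(X : (ZMod p × ZMod p)[X]) ^ n -
            Polynomial.C (ofFHom p lam + vR p * ofFHom p mu)})
          (Polynomial.C (vR p) * g1v.map (ofFHom p)),
         Ideal.Quotient.mk (Ideal.span {(X : (ZMod p × ZMod p)[X]) ^ n -
            Polynomial.C (ofFHom p lam + vR p * ofFHom p mu)})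
          ((1 - Polynomial.C (vR p)) * gv.map (ofFHom p))}))
    (hf1 : (X : (ZMod p)[X]) ^ n - Polynomial.C (lam + mu) = g1v * h1v)
    (hf2 : (X : (ZMod p)[X]) ^ n - Polynomial.C lam = gv * hv)
    (c : Fin n → ZMod p × ZMod p) :
    c ∈ D ↔ gv ∣ toPoly (fun i => (c i).1) ∧ g1v ∣ toPoly (fun i => (c i).2) := by
  have hv1 : RingHom.fst (ZMod p) (ZMod p) (vR p) = 0 := rfl
  have hv2 : RingHom.snd (ZMod p) (ZMod p) (vR p) = 1 := rfl
  have ho1 : ∀ a, RingHom.fst (ZMod p) (ZMod p) (ofFHom p a) = a := fun _ => rfl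
  have ho2 : ∀ a, RingHom.snd (ZMod p) (ZMod p) (ofFHom p a) = a := fun _ => rfl
  have hc1 : (toPoly c).map (RingHom.fst _ _) = toPoly (fun i => (c i).1) := map_toPoly _ c
  have hc2 : (toPoly c).map (RingHom.snd _ _) = toPoly (fun i => (c i).2) := map_toPoly _ c
  constructor
  · intro hc
    have hmem : Ideal.Quotient.mk _ (toPoly c) ∈ _ := (Set.ext_iff.1 hgen _).1 ⟨c, hc, rfl⟩
    rw [SetLike.mem_coe, Ideal.mem_span_pair] at hmem
    obtain ⟨a, b, hab⟩ := hmem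
    obtain ⟨a, rfl⟩ := Ideal.Quotient.mk_surjective a
    obtain ⟨b, rfl⟩ := Ideal.Quotient.mk_surjective b
    rw [← map_mul, ← map_mul, ← map_add, Ideal.Quotient.eq, Ideal.mem_span_singleton] at hab
    obtain ⟨q, hq⟩ := hab
    have e1 := congrArg (Polynomial.map (RingHom.fst (ZMod p) (ZMod p))) hq
    have e2 := congrArg (Polynomial.map (RingHom.snd (ZMod p) (ZMod p))) hq
    simp only [Polynomial.map_add, Polynomial.map_sub, Polynomial.map_mul, Polynomial.map_pow,
      map_X, map_C, Polynomial.map_one, map_add, map_mul, hv1, hv2, ho1, ho2, hc1, hc2,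
      Polynomial.map_map, fst_comp_ofFHom, snd_comp_ofFHom, Polynomial.map_id, map_zero, map_one,
      zero_mul, one_mul, mul_zero, add_zero, zero_add, sub_zero, sub_self] at e1 e2
    rw [hf2] at e1
    rw [← C_add, hf1] at e2
    exact ⟨⟨b.map (RingHom.fst _ _) - hv * q.map (RingHom.fst _ _), by
        linear_combination -e1⟩,
      ⟨a.map (RingHom.snd _ _) - h1v * q.map (RingHom.snd _ _), by linear_combination -e2⟩⟩
  · rintro ⟨⟨q1, hq1⟩, ⟨q2, hq2⟩⟩
    have hpoly : toPoly c = q2.map (ofFHom p) * (C (vR p) * g1v.map (ofFHom p)) +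
        q1.map (ofFHom p) * ((1 - C (vR p)) * gv.map (ofFHom p)) := by
      apply polynomial_prod_ext
      · simp only [hc1, hq1, Polynomial.map_add, Polynomial.map_sub, Polynomial.map_mul, map_C,
          Polynomial.map_one, hv1, Polynomial.map_map, fst_comp_ofFHom, Polynomial.map_id, map_zero]
        ring
      · simp only [hc2, hq2, Polynomial.map_add, Polynomial.map_sub, Polynomial.map_mul, map_C,
          Polynomial.map_one, hv2, Polynomial.map_map, snd_comp_ofFHom, Polynomial.map_id, map_one]
        ring
    obtain ⟨c', hc', heq⟩ := (Set.ext_iff.1 hgen (Ideal.Quotient.mk _ (toPoly c))).2 (by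
      rw [SetLike.mem_coe, Ideal.mem_span_pair]
      exact ⟨Ideal.Quotient.mk _ (q2.map (ofFHom p)), Ideal.Quotient.mk _ (q1.map (ofFHom p)), by
        rw [hpoly]
        simp only [map_add (Ideal.Quotient.mk _), map_mul (Ideal.Quotient.mk _)]⟩)
    rw [Ideal.Quotient.eq, Ideal.mem_span_singleton] at heq
    have hmonic := monic_X_pow_sub_C (ofFHom p lam + vR p * ofFHom p mu) hn.ne'
    have hz : toPoly c - toPoly c' = 0 := by
      by_contra hne
      refine hmonic.not_dvd_of_degree_lt hne ?_ heq
      rw [degree_X_pow_sub_C hn]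
      exact (degree_sub_le _ _).trans_lt (max_lt (degree_toPoly_lt c) (degree_toPoly_lt c'))
    have hcc : c = c' := by
      funext i
      have := congrArg (fun P => coeff P i) (sub_eq_zero.1 hz)
      simpa [coeff_toPoly] using this
    rwa [hcc]

theorem mem_dualCode_iff [Fact p.Prime] (hn : 0 < n) (hlam : lam ≠ 0) (hlm : lam + mu ≠ 0)
    {D : Set (Fin n → ZMod p × ZMod p)}
    (hD : ∀ c, c ∈ D ↔ gv ∣ toPoly (fun i => (c i).1) ∧ g1v ∣ toPoly (fun i => (c i).2))
    (hf1 : (X : (ZMod p)[X]) ^ n - Polynomial.C (lam + mu) = g1v * h1v)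
    (hf2 : (X : (ZMod p)[X]) ^ n - Polynomial.C lam = gv * hv)
    (u : Fin n → ZMod p × ZMod p) :
    u ∈ dualCode D ↔
      hv.reverse ∣ toPoly (fun i => (u i).1) ∧ h1v.reverse ∣ toPoly (fun i => (u i).2) := by
  rw [← mem_dual_iff_reverse_dvd hn hlam hf2, ← mem_dual_iff_reverse_dvd hn hlm hf1]
  have hzero : toPoly (fun _ : Fin n => (0 : ZMod p)) = 0 := by simp [toPoly]
  constructor
  · intro hu
    constructor
    · intro w hw
      have := hu (fun i => (w i, 0)) ((hD _).2 ⟨hw, by simp [hzero]⟩)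
      simpa [Prod.fst_sum] using congrArg Prod.fst this
    · intro w hw
      have := hu (fun i => (0, w i)) ((hD _).2 ⟨by simp [hzero], hw⟩)
      simpa [Prod.snd_sum] using congrArg Prod.snd this
  · rintro ⟨h1, h2⟩ w hw
    obtain ⟨hw1, hw2⟩ := (hD w).1 hw
    exact Prod.ext (by simpa [Prod.fst_sum] using h1 _ hw1)
      (by simpa [Prod.snd_sum] using h2 _ hw2)

end Components

/-- **Theorem 10.** Let `p` be an odd prime, `R = F_p + vF_p` with
`v² = v`, and `ϑ = 1 - 2v` or `ϑ = -1 + 2v`, written `ϑ = λ + vμ`.  Let `C` be a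
`ϑ`-constacyclic code of length `n` over `R` with generating set in standard form
`{v·g_{1-v}(x), (1-v)·g_v(x)}`; write `x^n - (λ+μ) = g_{1-v}(x)h_{1-v}(x)` and
`x^n - λ = g_v(x)h_v(x)`.  Then `φ_ϑ(C^⊥)` is the cyclic code `[h*_{1-v}(x)h*_v(x)]`
of length `2n` over `F_p` (under the identification of `F_p^{2n}` with
`F_p[x]/⟨x^{2n} - 1⟩`), and `φ_ϑ(C^⊥) = (φ_ϑ(C))^⊥`. -/
theorem gray_dual (p n : ℕ) (hp : p.Prime) (hodd : Odd p) (hn : 0 < n)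
    (lam mu : ZMod p) (hϑ : (lam = 1 ∧ mu = -2) ∨ (lam = -1 ∧ mu = 2))
    (C : Submodule (ZMod p × ZMod p) (Fin n → ZMod p × ZMod p))
    (hCc : IsConstacyclic (ofFHom p lam + vR p * ofFHom p mu)
      (C : Set (Fin n → ZMod p × ZMod p)))
    (g1v gv h1v hv : (ZMod p)[X])
    (hg1v_monic : g1v.Monic ∨ g1v = 0) (hgv_monic : gv.Monic ∨ gv = 0)
    (hg1v_dvd : g1v ≠ 0 → g1v ∣ (X : (ZMod p)[X]) ^ n - Polynomial.C (lam + mu))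
    (hgv_dvd : gv ≠ 0 → gv ∣ (X : (ZMod p)[X]) ^ n - Polynomial.C lam)
    (hgen : {x : (ZMod p × ZMod p)[X] ⧸
        Ideal.span {(X : (ZMod p × ZMod p)[X]) ^ n -
          Polynomial.C (ofFHom p lam + vR p * ofFHom p mu)} |
        ∃ c ∈ C, x = Ideal.Quotient.mk _ (toPoly c)} =
      ↑(Ideal.span
        {Ideal.Quotient.mk (Ideal.span {(X : (ZMod p × ZMod p)[X]) ^ n -
            Polynomial.C (ofFHom p lam + vR p * ofFHom p mu)})
          (Polynomial.C (vR p) * g1v.map (ofFHom p)),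
         Ideal.Quotient.mk (Ideal.span {(X : (ZMod p × ZMod p)[X]) ^ n -
            Polynomial.C (ofFHom p lam + vR p * ofFHom p mu)})
          ((1 - Polynomial.C (vR p)) * gv.map (ofFHom p))}))
    (hf1 : (X : (ZMod p)[X]) ^ n - Polynomial.C (lam + mu) = g1v * h1v)
    (hf2 : (X : (ZMod p)[X]) ^ n - Polynomial.C lam = gv * hv) :
    {y : (ZMod p)[X] ⧸ Ideal.span {(X : (ZMod p)[X]) ^ (2 * n) - 1} |
        ∃ u ∈ dualCode (C : Set (Fin n → ZMod p × ZMod p)),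
          y = Ideal.Quotient.mk (Ideal.span {(X : (ZMod p)[X]) ^ (2 * n) - 1})
            (toPoly (grayVec p n lam mu u))} =
      ↑(Ideal.span {Ideal.Quotient.mk (Ideal.span {(X : (ZMod p)[X]) ^ (2 * n) - 1})
          (recip h1v * recip hv)}) ∧
    grayVec p n lam mu '' dualCode (C : Set (Fin n → ZMod p × ZMod p)) =
      dualCode (grayVec p n lam mu '' (C : Set (Fin n → ZMod p × ZMod p))) := by
  have : Fact p.Prime := ⟨hp⟩
  have h2 : (2 : ZMod p) ≠ 0 := by
    intro h
    have : p ∣ 2 := (ZMod.natCast_eq_zero_iff 2 p).1 (by exact_mod_cast h)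
    have := (Nat.prime_dvd_prime_iff_eq hp Nat.prime_two).1 this
    subst this
    exact absurd hodd (by decide)
  have hl : lam * lam = 1 := by rcases hϑ with ⟨rfl, -⟩ | ⟨rfl, -⟩ <;> ring
  have hm : mu = -2 * lam := by rcases hϑ with ⟨rfl, rfl⟩ | ⟨rfl, rfl⟩ <;> ring
  have hlm : lam + mu = -lam := by rw [hm]; ring
  have hlmsq : (lam + mu) * (lam + mu) = 1 := by rw [hlm]; linear_combination hl
  have hlam0 : lam ≠ 0 := left_ne_zero_of_mul_eq_one hl
  have hlm0 : lam + mu ≠ 0 := left_ne_zero_of_mul_eq_one hlmsq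
  refine ⟨?_, grayVec_image_dualCode h2 hl hm C⟩
  have hdual := mem_dualCode_iff hn hlam0 hlm0 (mem_code_iff hn hgen hf1 hf2) hf1 hf2
  have hr1 := associated_recip (coeff_zero_ne_zero_of_X_pow_sub_C_eq_mul hn hlm0 hf1)
  have hr2 := associated_recip (coeff_zero_ne_zero_of_X_pow_sub_C_eq_mul hn hlam0 hf2)
  have hd1 : h1v.reverse ∣ X ^ n + Polynomial.C lam := by
    have := reverse_dvd_X_pow_sub_C hlmsq hf1
    rwa [hlm, C_neg, sub_neg_eq_add] at this
  have hd2 := reverse_dvd_X_pow_sub_C hl hf2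
  have hCl : (Polynomial.C lam * Polynomial.C lam : (ZMod p)[X]) = 1 := by rw [← C_mul, hl, C_1]
  have hhalf : (Polynomial.C 2⁻¹ * 2 : (ZMod p)[X]) = 1 := by
    rw [show (2 : (ZMod p)[X]) = Polynomial.C 2 from rfl, ← C_mul, inv_mul_cancel₀ h2, C_1]
  ext y
  rw [Set.mem_ofPred_eq, SetLike.mem_coe, Ideal.mem_span_singleton]
  constructor
  · rintro ⟨u, hu, rfl⟩
    obtain ⟨hu1, hu2⟩ := (hdual u).1 hu
    refine map_dvd _ ?_
    rw [(hr1.mul_mul hr2).dvd_iff_dvd_left, toPoly_grayVec hl hm]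
    refine Dvd.dvd.mul_left (dvd_add ?_ (mul_dvd_mul hu2 hd2)) _
    rw [mul_comm]
    exact mul_dvd_mul hu1 hd1
  · rintro ⟨z, rfl⟩
    obtain ⟨P, rfl⟩ := Ideal.Quotient.mk_surjective z
    rw [← map_mul]
    set G := recip h1v * recip hv * P with hG
    have hG1 : h1v.reverse ∣ G := (hr1.symm.dvd.mul_right _).mul_right _
    have hG2 : hv.reverse ∣ G := (hr2.symm.dvd.mul_left _).mul_right _
    have hM1 : (X ^ n + Polynomial.C lam : (ZMod p)[X]).Monic := monic_X_pow_add_C lam hn.ne'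
    have hM2 : (X ^ n - Polynomial.C lam : (ZMod p)[X]).Monic := monic_X_pow_sub_C lam hn.ne'
    set R1 := G %ₘ (X ^ n - Polynomial.C lam)
    set R2 := G %ₘ (X ^ n + Polynomial.C lam)
    set Q1 := G /ₘ (X ^ n - Polynomial.C lam)
    set Q2 := G /ₘ (X ^ n + Polynomial.C lam)
    have e1 : R1 + (X ^ n - Polynomial.C lam) * Q1 = G := modByMonic_add_div _ _
    have e2 : R2 + (X ^ n + Polynomial.C lam) * Q2 = G := modByMonic_add_div _ _
    have hR1d : hv.reverse ∣ R1 := (dvd_add_left (hd2.mul_right Q1)).1 (e1 ▸ hG2)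
    have hR2d : h1v.reverse ∣ R2 := (dvd_add_left (hd1.mul_right Q2)).1 (e2 ▸ hG1)
    have hA : (Polynomial.C 2⁻¹ * R1).degree < (n : WithBot ℕ) := by
      rw [degree_C_mul (inv_ne_zero h2)]
      exact (degree_modByMonic_lt _ hM2).trans_eq (degree_X_pow_sub_C hn _)
    have hB : (Polynomial.C (-2⁻¹) * R2).degree < (n : WithBot ℕ) := by
      rw [degree_C_mul (neg_ne_zero.2 (inv_ne_zero h2))]
      exact (degree_modByMonic_lt _ hM1).trans_eq (degree_X_pow_add_C hn _)
    refine ⟨fun i => ((Polynomial.C 2⁻¹ * R1).coeff i, (Polynomial.C (-2⁻¹) * R2).coeff i),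
      (hdual _).2 ⟨?_, ?_⟩, ?_⟩
    · simp only [toPoly_coeff hA]
      exact hR1d.mul_left _
    · simp only [toPoly_coeff hB]
      exact hR2d.mul_left _
    · rw [toPoly_grayVec hl hm]
      simp only [toPoly_coeff hA, toPoly_coeff hB]
      rw [Ideal.Quotient.eq, Ideal.mem_span_singleton]
      refine ⟨Polynomial.C 2⁻¹ * Polynomial.C lam * (Q1 - Q2), ?_⟩
      rw [C_neg]
      linear_combination
        -(Polynomial.C lam * Polynomial.C 2⁻¹ * (X ^ n + Polynomial.C lam)) * e1 +
        Polynomial.C lam * Polynomial.C 2⁻¹ * (X ^ n - Polynomial.C lam) * e2 -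
        (2 * Polynomial.C 2⁻¹ * G + Polynomial.C lam * Polynomial.C 2⁻¹ * (Q1 - Q2)) * hCl -
        G * hhalf
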